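/- Let R be a commutative Noetherian ring, a and b ideals with b ⊆ a, M a finitely generated R-module, and n a non-negative integer such that the set (Ass_R H_a^{f_a^b(M)_n}(M))_{≥ n} of associated primes p with dim R/p ≥ n is finite. Then f_a^b(M)_n = f_a^b(M)^n. -/

import Mathlib

open CategoryTheory

universe u

/-- Carrier of the `i`-th local cohomology module `H^i_a(M)` with support in `V(a)`. -/
noncomputable def locH (R : Type u) [CommRing R] (a : Ideal R) (i : ℕ)
    (M : Type u) [AddCommGroup M] [Module R M] : ModuleCat R :=
  (localCohomology a i).obj (ModuleCat.of R M)

/-- Krull dimension of the support of a module. -/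
noncomputable def dimSupp (R : Type u) [CommRing R]
    (M : Type u) [AddCommGroup M] [Module R M] : WithBot ℕ∞ :=
  Order.krullDim (Module.support R M)

/-- `f_a^b(M) = inf{i : b^n H^i_a(M) ≠ 0 for all n}`, the `b`-finiteness dimension
of `M` relative to `a` (`inf ∅ = ⊤`). -/
noncomputable def fab (R : Type u) [CommRing R] (a b : Ideal R)
    (M : Type u) [AddCommGroup M] [Module R M] : ℕ∞ :=
  sInf ((↑) '' {i : ℕ |
    ∀ n : ℕ, b ^ n • (⊤ : Submodule R (locH R a i M)) ≠ ⊥})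

/-- `f_a^b(M)_n = inf{i : dim Supp (b^t H^i_a(M)) ≥ n for all t}`. -/
noncomputable def fabn (R : Type u) [CommRing R] (a b : Ideal R)
    (M : Type u) [AddCommGroup M] [Module R M] (n : ℕ) : ℕ∞ :=
  sInf ((↑) '' {i : ℕ |
    ∀ t : ℕ, (n : WithBot ℕ∞) ≤ dimSupp R ↥(b ^ t • (⊤ : Submodule R (locH R a i M)))})

/-- `f_a^b(M)^n = inf{f_{aR_p}^{bR_p}(M_p) : p ∈ Spec R, dim R/p ≥ n}`. -/
noncomputable def fabUpper (R : Type u) [CommRing R] (a b : Ideal R)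
    (M : Type u) [AddCommGroup M] [Module R M] (n : ℕ) : ℕ∞ :=
  sInf {d : ℕ∞ | ∃ p : PrimeSpectrum R, (n : WithBot ℕ∞) ≤ ringKrullDim (R ⧸ p.asIdeal) ∧
    d = fab (Localization.AtPrime p.asIdeal)
      (a.map (algebraMap R (Localization.AtPrime p.asIdeal)))
      (b.map (algebraMap R (Localization.AtPrime p.asIdeal)))
      (LocalizedModule p.asIdeal.primeCompl M)}

/-- `f_a(M) = inf{i : H^i_a(M) is not finitely generated}`, the finiteness dimension. -/
noncomputable def finDim (R : Type u) [CommRing R] (a : Ideal R)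
    (M : Type u) [AddCommGroup M] [Module R M] : ℕ∞ :=
  sInf ((↑) '' {i : ℕ | ¬ Module.Finite R (locH R a i M)})

/-- The `i`-th Ext module `Ext^i_R(N, N')`. -/
noncomputable def extMod (R : Type u) [CommRing R] (i : ℕ)
    (N : Type u) [AddCommGroup N] [Module R N]
    (N' : Type u) [AddCommGroup N'] [Module R N'] : ModuleCat R :=
  ((Ext R (ModuleCat.{u} R) i).obj (Opposite.op (ModuleCat.of R N))).obj (ModuleCat.of R N')

/-- `N` is `b`-cofinite: `Supp N ⊆ V(b)` and `Ext^i_R(R/b, N)` is finitely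
generated for all `i ≥ 0`. -/
def IsCofinite (R : Type u) [CommRing R] (b : Ideal R)
    (N : Type u) [AddCommGroup N] [Module R N] : Prop :=
  Module.support R N ⊆ PrimeSpectrum.zeroLocus (b : Set R) ∧
    ∀ i : ℕ, Module.Finite R (extMod R i (R ⧸ b) N)

/-- `c_a^b(M) = inf{i : H^i_a(M) is not b-cofinite}`, the `b`-cofiniteness dimension. -/
noncomputable def cofDim (R : Type u) [CommRing R] (a b : Ideal R)
    (M : Type u) [AddCommGroup M] [Module R M] : ℕ∞ :=
  sInf ((↑) '' {i : ℕ | ¬ IsCofinite R b (locH R a i M)})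

/-- `depth(b, M)`: the supremum of lengths of `M`-regular sequences contained in `b`
(the common length of maximal `M`-regular sequences in `b`). -/
noncomputable def mdepth (R : Type u) [CommRing R] (b : Ideal R)
    (M : Type u) [AddCommGroup M] [Module R M] : ℕ∞ :=
  sSup {d : ℕ∞ | ∃ rs : List R, d = rs.length ∧ (∀ r ∈ rs, r ∈ b) ∧
    RingTheory.Sequence.IsRegular M rs}

/-- `f_a^n(M) = inf{f_{aR_p}(M_p) : p ∈ Supp(M/aM), dim R/p ≥ n}`. -/
noncomputable def fan (R : Type u) [CommRing R] (a : Ideal R)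
    (M : Type u) [AddCommGroup M] [Module R M] (n : ℕ) : ℕ∞ :=
  sInf {d : ℕ∞ | ∃ p : PrimeSpectrum R,
    p ∈ Module.support R (M ⧸ (a • ⊤ : Submodule R M)) ∧
    (n : WithBot ℕ∞) ≤ ringKrullDim (R ⧸ p.asIdeal) ∧
    d = finDim (Localization.AtPrime p.asIdeal)
      (a.map (algebraMap R (Localization.AtPrime p.asIdeal)))
      (LocalizedModule p.asIdeal.primeCompl M)}

/-- `M` is in dimension `< n`: there is a finitely generated submodule `N ⊆ M`
with `dim Supp (M/N) < n`. -/
def InDimLT (R : Type u) [CommRing R] (n : ℕ)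
    (M : Type u) [AddCommGroup M] [Module R M] : Prop :=
  ∃ N : Submodule R M, N.FG ∧ dimSupp R (M ⧸ N) < (n : WithBot ℕ∞)


noncomputable def yonMap {A : Type u} [CommRing A] {X X' : ModuleCat.{u} A}
    (P : ProjectiveResolution X) (Q : ProjectiveResolution X') (φ : P.complex ⟶ Q.complex)
    (Y : ModuleCat.{u} A) : Q.complex.linearYonedaObj A Y ⟶ P.complex.linearYonedaObj A Y :=
  (HomologicalComplex.unopFunctor _ _).map
    ((((linearYoneda A (ModuleCat.{u} A)).obj Y).rightOp.mapHomologicalComplex _).map φ).op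

lemma sq_paste {C : Type*} [Category C] {X1 X2 X3 Y1 Y2 Y3 : C} {a : X1 ⟶ Y1} {b : Y1 ⟶ Y2}
    {c : X1 ⟶ X2} {d : X2 ⟶ Y2} {e : Y2 ⟶ Y3} {e' : X2 ⟶ X3} {f : X3 ⟶ Y3}
    (h : a ≫ b = c ≫ d) (h' : d ≫ e = e' ≫ f) : a ≫ (b ≫ e) = (c ≫ e') ≫ f := by
  rw [← Category.assoc, h, Category.assoc, h', Category.assoc]

lemma sq_inv {C : Type*} [Category C] {X1 X2 Y1 Y2 : C} {f : X1 ⟶ X2} {eQ : X2 ≅ Y2}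
    {eP : X1 ≅ Y1} {g : Y1 ⟶ Y2} (h : f ≫ eQ.hom = eP.hom ≫ g) :
    eP.inv ≫ f = g ≫ eQ.inv := by
  rw [Iso.inv_comp_eq, ← Category.assoc, ← h, Category.assoc, Iso.hom_inv_id, Category.comp_id]

lemma isoExt_nat {A : Type u} [CommRing A] {X X' : ModuleCat.{u} A}
    (P : ProjectiveResolution X) (Q : ProjectiveResolution X') (g : X ⟶ X')
    (φ : P.complex ⟶ Q.complex) (comm : φ.f 0 ≫ Q.π.f 0 = P.π.f 0 ≫ g)
    (Y : ModuleCat.{u} A) (i : ℕ) :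
    ((Ext A (ModuleCat.{u} A) i).map g.op).app Y ≫ (P.isoExt (R := A) i Y).hom =
     (Q.isoExt i Y).hom ≫ HomologicalComplex.homologyMap (yonMap P Q φ Y) i := by
  have h := ProjectiveResolution.isoLeftDerivedObj_inv_naturality g P Q φ comm
    ((linearYoneda A (ModuleCat.{u} A)).obj Y).rightOp i
  have h2 := congrArg Quiver.Hom.unop h
  have h3 := HomologicalComplex.homologyOp_hom_naturality (yonMap P Q φ Y) i
  have h4 := congrArg Quiver.Hom.unop (sq_inv h3)
  exact sq_paste h2 h4

lemma homology_class {A : Type u} [CommRing A] (K : CochainComplex (ModuleCat.{u} A) ℕ)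
    (i j : ℕ) (hj : (ComplexShape.up ℕ).next i = j) (k : ℕ) (hk : (ComplexShape.up ℕ).prev i = k) :
    ∃ π : LinearMap.ker (K.d i j).hom →ₗ[A] K.homology i, Function.Surjective π ∧
      (∀ z, π z = 0 ↔ ∃ w : K.X k, (K.d k i).hom w = z.1) ∧
      (∀ z : K.cycles i, ∀ hz, π ⟨(K.iCycles i).hom z, hz⟩ = (K.homologyπ i).hom z) := by
  subst hj hk
  let e : K.cycles i ≅ ModuleCat.of A (LinearMap.ker (K.d i _).hom) := 
    ShortComplex.moduleCatCyclesIso (K.sc i)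
  have he : ∀ z, (e.hom.hom z).1 = (K.iCycles i).hom z := fun z => 
    congrArg (fun f => f.hom z) (ShortComplex.moduleCatCyclesIso_hom_i (K.sc i))
  have he' : ∀ z, (K.iCycles i).hom (e.inv.hom z) = z.1 := fun z => by
    rw [← he, Iso.inv_hom_id_apply] 
  have hepi : Function.Surjective (K.homologyπ i).hom := by
    rw [← ModuleCat.epi_iff_surjective]; infer_instance
  refine ⟨(K.homologyπ i).hom ∘ₗ e.inv.hom, ?_, ?_, ?_⟩
  · intro x
    obtain ⟨y, rfl⟩ := hepi x
    refine ⟨e.hom.hom y, ?_⟩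
    simp
  · intro z
    have hex := ShortComplex.exact_of_g_is_cokernel
      (ShortComplex.mk (K.toCycles ((ComplexShape.up ℕ).prev i) i) (K.homologyπ i) (by simp))
      (K.homologyIsCokernel _ i rfl)
    rw [ShortComplex.ShortExact.moduleCat_exact_iff_function_exact] at hex
    have := hex (e.inv.hom z)
    refine this.trans ?_
    refine exists_congr fun w => ?_
    constructor
    · intro h
      rw [← he', ← h]
      exact (congrArg (fun f => f.hom w) (K.toCycles_i _ i)).symm
    · intro h
      have hm : Function.Injective (K.iCycles i).hom := by
        rw [← ModuleCat.mono_iff_injective]; infer_instance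
      apply hm
      rw [he', ← h]
      exact (congrArg (fun f => f.hom w) (K.toCycles_i _ i))
  · intro z hz
    have : (⟨(K.iCycles i).hom z, hz⟩ : LinearMap.ker (K.d i _).hom) = e.hom.hom z :=
      Subtype.ext (he z).symm
    rw [this]; simp

/-- cocycles -/
def cocyc {A : Type u} [CommRing A] (C : ChainComplex (ModuleCat.{u} A) ℕ) (Y : Type u)
    [AddCommGroup Y] [Module A Y] (i : ℕ) : Submodule A (C.X i →ₗ[A] Y) :=
  LinearMap.ker (LinearMap.lcomp A Y (C.d (i+1) i).hom)

lemma ext_class {A : Type u} [CommRing A] {X : ModuleCat.{u} A} (P : ProjectiveResolution X)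
    (Y : Type u) [AddCommGroup Y] [Module A Y] (i : ℕ) :
    ∃ π : cocyc P.complex Y i →ₗ[A]
        (((Ext A (ModuleCat.{u} A) i).obj (Opposite.op X)).obj (ModuleCat.of A Y)),
      Function.Surjective π ∧
      (∀ z, π z = 0 ↔ ∃ w : P.complex.X ((ComplexShape.up ℕ).prev i) →ₗ[A] Y,
        w ∘ₗ (P.complex.d i ((ComplexShape.up ℕ).prev i)).hom = z.1) ∧
      (∀ z : (P.complex.linearYonedaObj A (ModuleCat.of A Y)).cycles i,
        ∀ f : P.complex.X i ⟶ ModuleCat.of A Y,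
        f = (HomologicalComplex.iCycles (P.complex.linearYonedaObj A (ModuleCat.of A Y)) i).hom z →
        ∀ hz, π ⟨f.hom, hz⟩ = (P.isoExt (R := A) i (ModuleCat.of A Y)).inv.hom
          ((HomologicalComplex.homologyπ (P.complex.linearYonedaObj A (ModuleCat.of A Y)) i).hom z)) := by
  obtain ⟨π, h1, h2, h3⟩ := homology_class (P.complex.linearYonedaObj A (ModuleCat.of A Y)) i (i+1)
    (by simp) _ rfl
  let c : cocyc P.complex Y i →ₗ[A]
    LinearMap.ker (HomologicalComplex.d (P.complex.linearYonedaObj A (ModuleCat.of A Y)) i (i+1)).hom :=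
    LinearMap.codRestrict _ ((ModuleCat.homLinearEquiv (S := A) (M := P.complex.X i) (N := ModuleCat.of A Y)).symm.toLinearMap ∘ₗ
      Submodule.subtype _) (by
      intro z
      rw [LinearMap.mem_ker]
      exact ModuleCat.hom_ext z.2)
  have hc : Function.Surjective c := by
    rintro ⟨(z : P.complex.X i ⟶ ModuleCat.of A Y), hz⟩
    refine ⟨⟨z.hom, ?_⟩, rfl⟩
    have : P.complex.d (i+1) i ≫ z = 0 := hz
    exact congrArg ModuleCat.Hom.hom this
  let e := (P.isoExt (R := A) i (ModuleCat.of A Y)).toLinearEquiv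
  refine ⟨e.symm.toLinearMap ∘ₗ π ∘ₗ c, ?_, ?_, ?_⟩
  · exact e.symm.surjective.comp (h1.comp hc)
  · intro z
    simp only [LinearMap.comp_apply, LinearEquiv.coe_coe, EmbeddingLike.map_eq_zero_iff]
    rw [h2]
    constructor
    · rintro ⟨(w : P.complex.X _ ⟶ ModuleCat.of A Y), hw⟩
      refine ⟨w.hom, ?_⟩
      have : P.complex.d i _ ≫ w = ModuleCat.ofHom z.1 := hw
      exact congrArg ModuleCat.Hom.hom this
    · rintro ⟨w, hw⟩
      exact ⟨ModuleCat.ofHom w, ModuleCat.hom_ext hw⟩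
  · rintro z f hf hz
    change e.symm (π (c ⟨f.hom, hz⟩)) = _
    have : c ⟨f.hom, hz⟩ = ⟨(HomologicalComplex.iCycles (P.complex.linearYonedaObj A (ModuleCat.of A Y)) i).hom z,
        hf ▸ (c ⟨f.hom, hz⟩).2⟩ := Subtype.ext hf
    rw [this, h3]
    rfl

/-- the class of a cocycle -/
noncomputable def extCls {A : Type u} [CommRing A] {X : ModuleCat.{u} A} (P : ProjectiveResolution X)
    (Y : Type u) [AddCommGroup Y] [Module A Y] (i : ℕ) : cocyc P.complex Y i →ₗ[A]
        (((Ext A (ModuleCat.{u} A) i).obj (Opposite.op X)).obj (ModuleCat.of A Y)) :=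
  (ext_class P Y i).choose

lemma cocyc_comp {A : Type u} [CommRing A] {C D : ChainComplex (ModuleCat.{u} A) ℕ} (φ : C ⟶ D)
    {Y : Type u} [AddCommGroup Y] [Module A Y] {i : ℕ} (z : cocyc D Y i) :
    z.1 ∘ₗ (φ.f i).hom ∈ cocyc C Y i := by
  have h1 : z.1 ∘ₗ (D.d (i+1) i).hom = 0 := z.2
  change (z.1 ∘ₗ (φ.f i).hom) ∘ₗ (C.d (i+1) i).hom = 0
  have h2 := congrArg ModuleCat.Hom.hom (φ.comm (i+1) i)
  simp only [ModuleCat.hom_comp] at h2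
  rw [LinearMap.comp_assoc, ← h2, ← LinearMap.comp_assoc, h1, LinearMap.zero_comp]

lemma cycles_lift {A : Type u} [CommRing A] (K : CochainComplex (ModuleCat.{u} A) ℕ)
    (i j : ℕ) (hj : (ComplexShape.up ℕ).next i = j) (f : K.X i) (hf : (K.d i j).hom f = 0) :
    ∃ z : K.cycles i, (K.iCycles i).hom z = f := by
  subst hj
  refine ⟨(ShortComplex.moduleCatCyclesIso (K.sc i)).inv.hom ⟨f, hf⟩, ?_⟩
  exact congrArg (fun g => g.hom (⟨f, hf⟩ : LinearMap.ker (K.d i _).hom))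
    (ShortComplex.moduleCatCyclesIso_inv_iCycles (K.sc i))

lemma extCls_nat {A : Type u} [CommRing A] {X X' : ModuleCat.{u} A}
    (P : ProjectiveResolution X) (Q : ProjectiveResolution X') (g : X ⟶ X')
    (φ : P.complex ⟶ Q.complex) (comm : φ.f 0 ≫ Q.π.f 0 = P.π.f 0 ≫ g)
    (Y : Type u) [AddCommGroup Y] [Module A Y] (i : ℕ) (z : cocyc Q.complex Y i) :
    (((Ext A (ModuleCat.{u} A) i).map g.op).app (ModuleCat.of A Y)).hom (extCls Q Y i z) =
      extCls P Y i ⟨z.1 ∘ₗ (φ.f i).hom, cocyc_comp φ z⟩ := by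
  obtain ⟨y, hy⟩ := cycles_lift (Q.complex.linearYonedaObj A (ModuleCat.of A Y)) i (i+1) (by simp)
    (ModuleCat.ofHom z.1) (ModuleCat.hom_ext z.2)
  have h1 := (ext_class Q Y i).choose_spec.2.2 y (ModuleCat.ofHom z.1) hy.symm z.2
  let y' := (HomologicalComplex.cyclesMap (yonMap P Q φ (ModuleCat.of A Y)) i).hom y
  have hy' : φ.f i ≫ ModuleCat.ofHom z.1 =
      (HomologicalComplex.iCycles (P.complex.linearYonedaObj A (ModuleCat.of A Y)) i).hom y' := by
    have := congrArg (fun f => f.hom y)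
      (HomologicalComplex.cyclesMap_i (yonMap P Q φ (ModuleCat.of A Y)) i)
    refine Eq.trans ?_ this.symm
    change _ = ((yonMap P Q φ (ModuleCat.of A Y)).f i).hom
      ((HomologicalComplex.iCycles (Q.complex.linearYonedaObj A (ModuleCat.of A Y)) i).hom y)
    rw [hy]
    rfl
  have h2 := (ext_class P Y i).choose_spec.2.2 y' (φ.f i ≫ ModuleCat.ofHom z.1) hy'
    (cocyc_comp φ z)
  refine (congrArg _ h1).trans (Eq.trans ?_ h2.symm)
  have h3 := isoExt_nat P Q g φ comm (ModuleCat.of A Y) i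
  have h3' := sq_inv (f := ((Ext A (ModuleCat.{u} A) i).map g.op).app (ModuleCat.of A Y)) h3
  have h4 := congrArg (fun f => f.hom y)
      (HomologicalComplex.homologyπ_naturality (yonMap P Q φ (ModuleCat.of A Y)) i)
  refine (congrArg (fun f => f.hom ((HomologicalComplex.homologyπ
    (Q.complex.linearYonedaObj A (ModuleCat.of A Y)) i).hom y)) h3').trans ?_
  exact congrArg (P.isoExt (R := A) i (ModuleCat.of A Y)).inv.hom h4

/-- the resolution data for powers of an ideal -/
structure PowRes (A : Type u) [CommRing A] (J : Ideal A) where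
  P : ∀ t : ℕ, ProjectiveResolution (ModuleCat.of A (A ⧸ J ^ t))
  φ : ∀ s t : ℕ, s ≤ t → ((P t).complex ⟶ (P s).complex)
  comm : ∀ s t (h : s ≤ t), (φ s t h).f 0 ≫ (P s).π.f 0 =
    (P t).π.f 0 ≫ ModuleCat.ofHom (Submodule.mapQ (J ^ t) (J ^ s) LinearMap.id (Ideal.pow_le_pow_right h))

lemma locH_class {A : Type u} [CommRing A] (J : Ideal A) (D : PowRes A J)
    (Y : Type u) [AddCommGroup Y] [Module A Y] (i : ℕ) :
    ∃ π : ∀ t, cocyc (D.P t).complex Y i →ₗ[A] locH A J i Y,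
      (∀ x, ∃ t z, π t z = x) ∧
      (∀ t z, π t z = 0 ↔ ∃ t', ∃ h : t ≤ t',
        ∃ w : (D.P t').complex.X ((ComplexShape.up ℕ).prev i) →ₗ[A] Y,
        w ∘ₗ ((D.P t').complex.d i ((ComplexShape.up ℕ).prev i)).hom =
          z.1 ∘ₗ ((D.φ t t' h).f i).hom) := by
  let F := localCohomology.diagram (localCohomology.idealPowersDiagram J) i
  have hFc := localCohomology.hasColimitDiagram (localCohomology.idealPowersDiagram J) i
  let ev := (evaluation (ModuleCat.{u} A) (ModuleCat.{u} A)).obj (ModuleCat.of A Y)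
  let c := ev.mapCocone (Limits.colimit.cocone F)
  have hc : Limits.IsColimit c := Limits.isColimitOfPreserves ev (Limits.colimit.isColimit F)
  have : Limits.PreservesFilteredColimitsOfSize.{0, 0} (forget (ModuleCat.{u} A)) :=
    Limits.preservesFilteredColimitsOfSize_shrink.{0, u, 0, u} _
  have : IsFiltered (ℕᵒᵖᵒᵖ) := IsFiltered.of_equivalence (opOpEquivalence ℕ).symm
  have : Limits.PreservesColimit (F ⋙ ev) (forget (ModuleCat A)) := inferInstance
  have hc' := Limits.isColimitOfPreserves (forget (ModuleCat.{u} A)) hc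
  let ι : ∀ t : ℕ, (((Ext A (ModuleCat.{u} A) i).obj (Opposite.op (ModuleCat.of A (A ⧸ J ^ t)))).obj (ModuleCat.of A Y)) →ₗ[A] locH A J i Y := fun t => (c.ι.app (Opposite.op (Opposite.op t))).hom
  refine ⟨fun t => ι t ∘ₗ extCls (D.P t) Y i, ?_, ?_⟩
  · intro x
    obtain ⟨t, y, hy⟩ := Limits.Types.jointly_surjective _ hc' x
    obtain ⟨z, rfl⟩ := (ext_class (D.P t.unop.unop) Y i).choose_spec.1 y
    exact ⟨t.unop.unop, z, hy⟩
  · intro t z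
    have h0 : (ι t ∘ₗ extCls (D.P t) Y i) z = 0 ↔ ∃ t', ∃ h : t ≤ t', extCls (D.P t') Y i ⟨z.1 ∘ₗ ((D.φ t t' h).f i).hom, cocyc_comp _ z⟩ = 0 := by
      have h1 : ∀ t' (h : t ≤ t'), ((F ⋙ ev).map (homOfLE h).op.op).hom (extCls (D.P t) Y i z) = extCls (D.P t') Y i ⟨z.1 ∘ₗ ((D.φ t t' h).f i).hom, cocyc_comp _ z⟩ :=
        fun t' h => extCls_nat (D.P t') (D.P t) _ _ (D.comm t t' h) Y i z
      have h2 := Limits.Types.FilteredColimit.isColimit_eq_iff' hc'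
        (i := Opposite.op (Opposite.op t)) (extCls (D.P t) Y i z)
        (0 : (((Ext A (ModuleCat.{u} A) i).obj
          (Opposite.op (ModuleCat.of A (A ⧸ J ^ t)))).obj (ModuleCat.of A Y)))
      have h3 : (ι t ∘ₗ extCls (D.P t) Y i) z = 0 ↔
          ι t (extCls (D.P t) Y i z) = ι t 0 := by rw [map_zero]; rfl
      rw [h3]
      refine h2.trans ?_
      constructor
      · rintro ⟨⟨⟨t'⟩⟩, f, hf⟩
        have h : t ≤ t' := leOfHom f.unop.unop
        refine ⟨t', h, ?_⟩
        rw [← h1 t' h]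
        exact Eq.trans hf (map_zero ((F ⋙ ev).map f).hom)
      · rintro ⟨t', h, he⟩
        refine ⟨Opposite.op (Opposite.op t'), (homOfLE h).op.op, ?_⟩
        rw [← h1 t' h] at he
        exact Eq.trans he (map_zero ((F ⋙ ev).map (homOfLE h).op.op).hom).symm
    rw [h0]
    refine exists_congr fun t' => exists_congr fun h => ?_
    exact (ext_class (D.P t') Y i).choose_spec.2.1 _

/-- A resolution from exactness data. -/
noncomputable def mkRes {A : Type u} [CommRing A] {Z : ModuleCat.{u} A}
    (C : ChainComplex (ModuleCat.{u} A) ℕ) (hp : ∀ n, Projective (C.X n)) (ε : C.X 0 ⟶ Z)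
    (w : C.d 1 0 ≫ ε = 0)
    (ex : ∀ n, (ShortComplex.mk _ _ (C.d_comp_d (n + 2) (n + 1) n)).Exact)
    (ex0 : (ShortComplex.mk _ _ w).Exact) (hε : Epi ε) : ProjectiveResolution Z where
  complex := C
  projective := hp
  π := (ChainComplex.toSingle₀Equiv _ _).symm ⟨ε, w⟩
  quasiIso := ⟨fun n => by
    rcases n with _ | n
    · rw [ChainComplex.quasiIsoAt₀_iff, ShortComplex.quasiIso_iff_of_zeros']
      · refine (ShortComplex.exact_and_epi_g_iff_of_iso ?_).2 ⟨ex0, hε⟩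
        refine ShortComplex.isoMk (Iso.refl _) (Iso.refl _) (Iso.refl _)
          ((Category.id_comp _).trans (Category.comp_id _).symm) ?_
        exact (Category.id_comp _).trans (Eq.trans (by simp; rfl) (Category.comp_id _).symm)
      · exact C.shape _ _ (by simp)
      · rfl
      · rfl
    · rw [quasiIsoAt_iff_exactAt']
      · rw [HomologicalComplex.exactAt_iff' _ (n + 1 + 1) (n + 1) n (by simp) (by simp)]
        exact ex _
      · apply ChainComplex.exactAt_succ_single_obj⟩

lemma mkRes_π {A : Type u} [CommRing A] {Z : ModuleCat.{u} A}
    (C : ChainComplex (ModuleCat.{u} A) ℕ) (hp : ∀ n, Projective (C.X n)) (ε : C.X 0 ⟶ Z)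
    (w : C.d 1 0 ≫ ε = 0)
    (ex : ∀ n, (ShortComplex.mk _ _ (C.d_comp_d (n + 2) (n + 1) n)).Exact)
    (ex0 : (ShortComplex.mk _ _ w).Exact) (hε : Epi ε) :
    (mkRes C hp ε w ex ex0 hε).π.f 0 = ε := by
  simp [mkRes]

/-- an arrow with finite source -/
structure FinArr (A : Type u) [CommRing A] where
  X : ModuleCat.{u} A
  Y : ModuleCat.{u} A
  f : X ⟶ Y
  fin : Module.Finite A X
  proj : Module.Projective A X

lemma FinArr.exists_next {A : Type u} [CommRing A] [IsNoetherianRing A] (a : FinArr A) :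
    ∃ k : ℕ, ∃ g : (Fin k → A) →ₗ[A] a.X, Function.Exact g a.f.hom := by
  have := a.fin
  obtain ⟨k, g, hg⟩ := Module.Finite.exists_fin' A (LinearMap.ker a.f.hom)
  refine ⟨k, (LinearMap.ker a.f.hom).subtype ∘ₗ g, ?_⟩
  rw [LinearMap.exact_iff, LinearMap.range_comp, LinearMap.range_eq_top.2 hg]
  simp

noncomputable def FinArr.next {A : Type u} [CommRing A] [IsNoetherianRing A] (a : FinArr A) :
    FinArr A where
  X := ModuleCat.of A (Fin a.exists_next.choose → A)
  Y := a.X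
  f := ModuleCat.ofHom a.exists_next.choose_spec.choose
  fin := inferInstanceAs (Module.Finite A (Fin _ → A))
  proj := inferInstanceAs (Module.Projective A (Fin _ → A))

lemma FinArr.next_exact {A : Type u} [CommRing A] [IsNoetherianRing A] (a : FinArr A) :
    Function.Exact a.next.f.hom a.f.hom := a.exists_next.choose_spec.choose_spec

noncomputable def FinArr.seq {A : Type u} [CommRing A] [IsNoetherianRing A] (a : FinArr A) :
    ℕ → FinArr A
  | 0 => a
  | n + 1 => (a.seq n).next

lemma fg_res {A : Type u} [CommRing A] [IsNoetherianRing A] (Z : ModuleCat.{u} A)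
    [Module.Finite A Z] :
    ∃ P : ProjectiveResolution Z, ∀ n, Module.Finite A (P.complex.X n) := by
  obtain ⟨k, g, hg⟩ := Module.Finite.exists_fin' A Z
  let a : FinArr A := ⟨ModuleCat.of A (Fin k → A), Z, ModuleCat.ofHom g,
    inferInstanceAs (Module.Finite A (Fin _ → A)), inferInstanceAs (Module.Projective A (Fin _ → A))⟩
  let C : ChainComplex (ModuleCat.{u} A) ℕ := ChainComplex.of (fun n => (a.seq n).X)
    (fun n => (a.seq (n+1)).f) (fun n => by
      ext x
      exact (a.seq (n+1)).next_exact.apply_apply_eq_zero x)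
  have hd : ∀ n, C.d (n+1) n = (a.seq (n+1)).f := fun n =>
    ChainComplex.of_d (fun n => (a.seq n).X) (fun n => (a.seq (n+1)).f) n
  have hp : ∀ n, Projective (C.X n) := fun n =>
    (IsProjective.iff_projective (C.X n)).1 (a.seq n).proj
  have w : C.d 1 0 ≫ (ModuleCat.ofHom g : C.X 0 ⟶ Z) = 0 := by
    rw [hd 0]
    ext x
    exact (a.seq 0).next_exact.apply_apply_eq_zero x
  refine ⟨mkRes C hp (ModuleCat.ofHom g) w ?_ ?_ ?_, fun n => (a.seq n).fin⟩
  · intro n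
    rw [ShortComplex.ShortExact.moduleCat_exact_iff_function_exact]
    change Function.Exact (C.d (n+2) (n+1)).hom (C.d (n+1) n).hom
    rw [hd, hd]
    exact (a.seq (n+1)).next_exact
  · rw [ShortComplex.ShortExact.moduleCat_exact_iff_function_exact]
    change Function.Exact (C.d 1 0).hom g
    rw [hd]
    exact (a.seq 0).next_exact
  · exact (ModuleCat.epi_iff_surjective (ModuleCat.ofHom g)).2 hg

lemma exists_powRes {A : Type u} [CommRing A] [IsNoetherianRing A] (J : Ideal A) :
    ∃ D : PowRes A J, ∀ t n, Module.Finite A ((D.P t).complex.X n) := by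
  choose P hP using fun t : ℕ => fg_res (ModuleCat.of A (A ⧸ J ^ t))
  refine ⟨⟨P, fun s t h => ProjectiveResolution.lift
    (ModuleCat.ofHom (Submodule.mapQ _ _ LinearMap.id (Ideal.pow_le_pow_right h))) (P t) (P s), ?_⟩, hP⟩
  intro s t h
  exact ProjectiveResolution.lift_commutes_zero _ _ _

lemma zero_comp3 {C D : Type*} [Category C] [Category D] [Preadditive C] [Preadditive D]
    (F : C ⥤ D) [F.Additive] (K : ChainComplex C ℕ) {Z : C} {W : D} (ε : K.X 0 ⟶ Z)
    (w : K.d 1 0 ≫ ε = 0) (e : F.obj Z ⟶ W) :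
    HomologicalComplex.d ((F.mapHomologicalComplex _).obj K) 1 0 ≫ (F.map ε ≫ e) = 0 := by
  have h : F.map (K.d 1 0) ≫ (F.map ε ≫ e) = 0 := by
    rw [← Category.assoc, ← F.map_comp, w, F.map_zero, Limits.zero_comp]
  exact h

lemma ex_gen {C D : Type*} [Category C] [Category D] [Preadditive C] [Preadditive D]
    (F : C ⥤ D) [F.Additive] (hF : ∀ T : ShortComplex C, T.Exact → (T.map F).Exact)
    (K : ChainComplex C ℕ) (n : ℕ)
    (h : (ShortComplex.mk _ _ (K.d_comp_d (n + 2) (n + 1) n)).Exact) :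
    (ShortComplex.mk _ _ (HomologicalComplex.d_comp_d ((F.mapHomologicalComplex _).obj K)
      (n + 2) (n + 1) n)).Exact := hF _ h

lemma ex0_gen {C D : Type*} [Category C] [Category D] [Preadditive C] [Preadditive D]
    (F : C ⥤ D) [F.Additive] (hF : ∀ T : ShortComplex C, T.Exact → (T.map F).Exact)
    (K : ChainComplex C ℕ) {Z : C} {W : D} (ε : K.X 0 ⟶ Z)
    (w : K.d 1 0 ≫ ε = 0) (e : F.obj Z ≅ W) (h : (ShortComplex.mk _ _ w).Exact) :
    (ShortComplex.mk _ _ (zero_comp3 F K ε w e.hom)).Exact := by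
  refine (ShortComplex.exact_iff_of_iso ?_).1 (hF _ h)
  exact ShortComplex.isoMk (Iso.refl _) (Iso.refl _) e
    ((Category.id_comp _).trans (Category.comp_id _).symm) (Category.id_comp _)

lemma epi_gen {C D : Type*} [Category C] [Category D] (F : C ⥤ D) [F.PreservesEpimorphisms]
    {X Z : C} {W : D} (ε : X ⟶ Z) (hε : Epi ε) (e : F.obj Z ≅ W) : Epi (F.map ε ≫ e.hom) :=
  epi_comp _ _

lemma sq_map {C D : Type*} [Category C] [Category D] (F : C ⥤ D)
    {X Y Z W : C} {f : X ⟶ Y} {g : Y ⟶ W} {f' : X ⟶ Z} {g' : Z ⟶ W} (h : f ≫ g = f' ≫ g') :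
    F.map f ≫ F.map g = F.map f' ≫ F.map g' := by
  rw [← F.map_comp, h, F.map_comp]

section loc

variable {R : Type u} [CommRing R] (S : Submonoid R)

lemma loc_iso (J : Ideal R) (t : ℕ) :
    ∃ e : (ModuleCat.of R (R ⧸ J ^ t)).localizedModule S ≅
      ModuleCat.of (Localization S) (Localization S ⧸ (J.map (algebraMap R (Localization S))) ^ t),
      ∀ r : R, e.hom.hom ((ModuleCat.of R (R ⧸ J ^ t)).localizedModuleMkLinearMap S
        (Submodule.Quotient.mk r)) = Submodule.Quotient.mk (algebraMap R (Localization S) r) := by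
  have h0 : (J ^ t).localized' (Localization S) S (Algebra.linearMap R (Localization S)) =
      (J.map (algebraMap R (Localization S))) ^ t := by
    rw [Ideal.localized'_eq_map, Ideal.map_pow]
  rw [← h0]
  have : IsLocalizedModule S ((ModuleCat.of R (R ⧸ J ^ t)).localizedModuleMkLinearMap S) :=
    ModuleCat.localizedModule_isLocalizedModule (ModuleCat.of R (R ⧸ J ^ t)) S
  let g := Submodule.toLocalizedQuotient' (Localization S) S
    (Algebra.linearMap R (Localization S)) (J ^ t)
  let e := IsLocalizedModule.linearEquiv S
    ((ModuleCat.of R (R ⧸ J ^ t)).localizedModuleMkLinearMap S) g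
  let e' := LinearEquiv.extendScalarsOfIsLocalization S (Localization S) e
  refine ⟨LinearEquiv.toModuleIso e', fun r => ?_⟩
  exact IsLocalizedModule.linearEquiv_apply S
    ((ModuleCat.of R (R ⧸ J ^ t)).localizedModuleMkLinearMap S) g _

lemma loc_ext {X : ModuleCat.{u} R} {Y : ModuleCat.{u} (Localization S)}
    (f g : X.localizedModule S ⟶ Y) (h : ∀ x, f.hom (X.localizedModuleMkLinearMap S x) =
      g.hom (X.localizedModuleMkLinearMap S x)) : f = g := by
  ext y
  obtain ⟨⟨x, s⟩, hx⟩ := IsLocalizedModule.surj S (X.localizedModuleMkLinearMap S) y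
  have hu : IsUnit (algebraMap R (Localization S) s) := IsLocalization.map_units _ s
  have hx' : algebraMap R (Localization S) s • y = X.localizedModuleMkLinearMap S x := by
    rw [← hx, algebraMap_smul]; rfl
  have := h x
  rw [← hx', map_smul, map_smul] at this
  exact hu.smul_left_cancel.1 this

lemma locMap_apply {X Y : ModuleCat.{u} R} (f : X ⟶ Y) (x : X) :
    (ModuleCat.localizedModuleMap S f).hom (X.localizedModuleMkLinearMap S x) =
      Y.localizedModuleMkLinearMap S (f.hom x) :=
  IsLocalizedModule.map_apply S (X.localizedModuleMkLinearMap S) (Y.localizedModuleMkLinearMap S)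
    f.hom x

noncomputable def locIso (J : Ideal R) (t : ℕ) := (loc_iso S J t).choose

lemma loc_proj (X : ModuleCat.{u} R) (h : Projective X) : Projective (X.localizedModule S) := by
  have h1 := (IsProjective.iff_projective X).2 h
  have h2 : Module.Projective (Localization S) (X.localizedModule S) :=
    Module.projective_of_isLocalizedModule S (X.localizedModuleMkLinearMap S)
  exact (IsProjective.iff_projective (X.localizedModule S)).1 h2

noncomputable def locRes (J : Ideal R) (t : ℕ)
    (P : ProjectiveResolution (ModuleCat.of R (R ⧸ J ^ t))) :
    ProjectiveResolution (ModuleCat.of (Localization S)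
      (Localization S ⧸ (J.map (algebraMap R (Localization S))) ^ t)) :=
  mkRes (((ModuleCat.localizedModuleFunctor S).mapHomologicalComplex _).obj P.complex)
    (fun n => loc_proj S _ (P.projective n))
    ((ModuleCat.localizedModuleFunctor S).map (P.π.f 0) ≫ (locIso S J t).hom)
    (zero_comp3 (ModuleCat.localizedModuleFunctor S) P.complex (P.π.f 0)
      P.complex_d_comp_π_f_zero (locIso S J t).hom)
    (fun n => ex_gen (ModuleCat.localizedModuleFunctor S)
      (ModuleCat.localizedModuleFunctor_map_exact S) P.complex n (P.exact_succ n))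
    (ex0_gen (ModuleCat.localizedModuleFunctor S)
      (ModuleCat.localizedModuleFunctor_map_exact S) P.complex (P.π.f 0)
      P.complex_d_comp_π_f_zero (locIso S J t)
      (ShortComplex.exact_of_g_is_cokernel (ShortComplex.mk _ _ P.complex_d_comp_π_f_zero)
          P.isColimitCokernelCofork))
    (epi_gen (ModuleCat.localizedModuleFunctor S) (P.π.f 0) inferInstance (locIso S J t))

lemma locRes_π (J : Ideal R) (t : ℕ) (P : ProjectiveResolution (ModuleCat.of R (R ⧸ J ^ t))) :
    (locRes S J t P).π.f 0 =
      (ModuleCat.localizedModuleFunctor S).map (P.π.f 0) ≫ (locIso S J t).hom :=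
  mkRes_π _ _ _ _ _ _ _

noncomputable def locPowRes (J : Ideal R) (D : PowRes R J) :
    PowRes (Localization S) (J.map (algebraMap R (Localization S))) where
  P t := locRes S J t (D.P t)
  φ s t h := ((ModuleCat.localizedModuleFunctor S).mapHomologicalComplex _).map (D.φ s t h)
  comm s t h := by
    rw [locRes_π, locRes_π]
    have h1 := sq_map (ModuleCat.localizedModuleFunctor S) (D.comm s t h)
    have h2 : (ModuleCat.localizedModuleFunctor S).map
        (ModuleCat.ofHom (Submodule.mapQ (J ^ t) (J ^ s) LinearMap.id (Ideal.pow_le_pow_right h))) ≫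
        (locIso S J s).hom = (locIso S J t).hom ≫ ModuleCat.ofHom (Submodule.mapQ _ _ LinearMap.id
          (Ideal.pow_le_pow_right h)) := by
      apply loc_ext
      intro x
      obtain ⟨r, rfl⟩ := Submodule.Quotient.mk_surjective _ x
      have e1 := (loc_iso S J s).choose_spec r
      have e2 := (loc_iso S J t).choose_spec r
      have e3 : ((ModuleCat.localizedModuleFunctor S).map (ModuleCat.ofHom
          (Submodule.mapQ (J ^ t) (J ^ s) LinearMap.id (Ideal.pow_le_pow_right h)))).hom
          ((ModuleCat.of R (R ⧸ J ^ t)).localizedModuleMkLinearMap S (Submodule.Quotient.mk r)) =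
          (ModuleCat.of R (R ⧸ J ^ s)).localizedModuleMkLinearMap S (Submodule.Quotient.mk r) :=
        locMap_apply S _ _
      refine (congrArg (locIso S J s).hom.hom e3).trans (e1.trans ?_)
      exact (congrArg (ModuleCat.ofHom (Submodule.mapQ _ _ LinearMap.id
          (Ideal.pow_le_pow_right h))).hom e2).symm
    exact sq_paste h1 h2
end loc

section kill

variable {R : Type u} [CommRing R] (S : Submonoid R) (M : Type u) [AddCommGroup M] [Module R M]

/-- localization of a linear map -/
noncomputable def locHom (X : ModuleCat.{u} R) (f : X →ₗ[R] M) :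
    X.localizedModule S →ₗ[Localization S] LocalizedModule S M :=
  IsLocalizedModule.mapExtendScalars S (X.localizedModuleMkLinearMap S)
    (LocalizedModule.mkLinearMap S M) (Localization S) f

lemma locHom_apply (X : ModuleCat.{u} R) (f : X →ₗ[R] M) (x : X) :
    locHom S M X f (X.localizedModuleMkLinearMap S x) = LocalizedModule.mkLinearMap S M (f x) :=
  IsLocalizedModule.map_apply S (X.localizedModuleMkLinearMap S)
    (LocalizedModule.mkLinearMap S M) f x

lemma locHom_ext {X : ModuleCat.{u} R} {Y : Type u} [AddCommGroup Y] [Module (Localization S) Y]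
    (f g : X.localizedModule S →ₗ[Localization S] Y)
    (h : ∀ x, f (X.localizedModuleMkLinearMap S x) = g (X.localizedModuleMkLinearMap S x)) :
    f = g :=
  congrArg ModuleCat.Hom.hom (loc_ext S (ModuleCat.ofHom f) (ModuleCat.ofHom g) h)

lemma locHom_sub (X : ModuleCat.{u} R) (f g : X →ₗ[R] M) :
    locHom S M X (f - g) = locHom S M X f - locHom S M X g := by
  apply locHom_ext
  intro x
  rw [LinearMap.sub_apply, locHom_apply, locHom_apply, locHom_apply, LinearMap.sub_apply, map_sub]

lemma locHom_smul (X : ModuleCat.{u} R) (r : R) (f : X →ₗ[R] M) :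
    locHom S M X (r • f) = algebraMap R (Localization S) r • locHom S M X f := by
  apply locHom_ext
  intro x
  rw [LinearMap.smul_apply, locHom_apply, locHom_apply, LinearMap.smul_apply, map_smul,
    algebraMap_smul]

lemma locHom_comp {X Y : ModuleCat.{u} R} (f : Y →ₗ[R] M) (g : X ⟶ Y) :
    locHom S M X (f ∘ₗ g.hom) = locHom S M Y f ∘ₗ (ModuleCat.localizedModuleMap S g).hom := by
  apply locHom_ext
  intro x
  rw [LinearMap.comp_apply, locHom_apply, locMap_apply, locHom_apply, LinearMap.comp_apply]

lemma locHom_surj [IsNoetherianRing R] (X : ModuleCat.{u} R) [Module.Finite R X]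
    (g : X.localizedModule S →ₗ[Localization S] LocalizedModule S M) :
    ∃ s ∈ S, ∃ f, algebraMap R (Localization S) s • g = locHom S M X f := by
  have : Module.FinitePresentation R X := Module.finitePresentation_of_finite R X
  obtain ⟨⟨f, s⟩, h⟩ := IsLocalizedModule.surj S
    (IsLocalizedModule.mapExtendScalars S (X.localizedModuleMkLinearMap S)
    (LocalizedModule.mkLinearMap S M) (Localization S)) g
  refine ⟨s, s.2, f, ?_⟩
  refine Eq.trans ?_ h
  ext x
  rw [LinearMap.smul_apply, algebraMap_smul]
  rfl

lemma locHom_inj [IsNoetherianRing R] (X : ModuleCat.{u} R) [Module.Finite R X]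
    (f : X →ₗ[R] M) (h : locHom S M X f = 0) : ∃ s ∈ S, s • f = 0 := by
  have : Module.FinitePresentation R X := Module.finitePresentation_of_finite R X
  obtain ⟨s, hs⟩ := (IsLocalizedModule.eq_zero_iff S
    (IsLocalizedModule.mapExtendScalars S (X.localizedModuleMkLinearMap S)
    (LocalizedModule.mkLinearMap S M) (Localization S))).1 h
  exact ⟨s, s.2, hs⟩

variable (J : Ideal R) (D : PowRes R J)

/-- localization of cochains -/
noncomputable def LH (t i : ℕ) (f : (D.P t).complex.X i →ₗ[R] M) :
    ((locPowRes S J D).P t).complex.X i →ₗ[Localization S] LocalizedModule S M :=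
  locHom S M _ f

lemma LH_d (t i j : ℕ) (f : (D.P t).complex.X j →ₗ[R] M) :
    LH S M J D t i (f ∘ₗ ((D.P t).complex.d i j).hom) =
      LH S M J D t j f ∘ₗ (((locPowRes S J D).P t).complex.d i j).hom :=
  locHom_comp S M f _

lemma LH_φ (t t' i : ℕ) (h : t ≤ t') (f : (D.P t).complex.X i →ₗ[R] M) :
    LH S M J D t' i (f ∘ₗ ((D.φ t t' h).f i).hom) =
      LH S M J D t i f ∘ₗ (((locPowRes S J D).φ t t' h).f i).hom :=
  locHom_comp S M f _

lemma LH_smul (t i : ℕ) (r : R) (f : (D.P t).complex.X i →ₗ[R] M) :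
    LH S M J D t i (r • f) = algebraMap R (Localization S) r • LH S M J D t i f :=
  locHom_smul S M _ r f

lemma LH_sub (t i : ℕ) (f g : (D.P t).complex.X i →ₗ[R] M) :
    LH S M J D t i (f - g) = LH S M J D t i f - LH S M J D t i g :=
  locHom_sub S M _ f g

lemma LH_zero (t i : ℕ) : LH S M J D t i 0 = 0 := by
  have := LH_smul S M J D t i 0 0
  rwa [map_zero, zero_smul, zero_smul] at this

variable [IsNoetherianRing R]

lemma LH_surj (t i : ℕ) (hD : Module.Finite R ((D.P t).complex.X i))
    (g : ((locPowRes S J D).P t).complex.X i →ₗ[Localization S] LocalizedModule S M) :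
    ∃ s ∈ S, ∃ f, algebraMap R (Localization S) s • g = LH S M J D t i f :=
  locHom_surj S M _ g

lemma LH_inj (t i : ℕ) (hD : Module.Finite R ((D.P t).complex.X i))
    (f : (D.P t).complex.X i →ₗ[R] M) (h : LH S M J D t i f = 0) : ∃ s ∈ S, s • f = 0 :=
  locHom_inj S M _ f h

lemma kill_elt (i : ℕ) (r : R) :
    (∀ x : locH (Localization S) (J.map (algebraMap R (Localization S))) i (LocalizedModule S M),
      algebraMap R (Localization S) r • x = 0) ↔
    ∀ x : locH R J i M, ∃ s ∈ S, s • r • x = 0 := by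
  obtain ⟨D, hD⟩ := exists_powRes J
  obtain ⟨π, h1, h2⟩ := locH_class J D M i
  obtain ⟨π', h1', h2'⟩ := locH_class _ (locPowRes S J D) (LocalizedModule S M) i
  constructor
  · intro H x
    obtain ⟨t, f, rfl⟩ := h1 x
    have hf : f.1 ∘ₗ ((D.P t).complex.d (i+1) i).hom = 0 := f.2
    have hg : LH S M J D t i f.1 ∘ₗ (((locPowRes S J D).P t).complex.d (i+1) i).hom = 0 := by
      rw [← LH_d, hf, LH_zero]
    have H' := H (π' t ⟨LH S M J D t i f.1, hg⟩)
    rw [← map_smul, h2'] at H'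
    obtain ⟨t', h, w', hw'⟩ := H'
    obtain ⟨s, hs, w, hw⟩ := LH_surj S M J D t' _ (hD _ _) w'
    have e : LH S M J D t' i (w ∘ₗ ((D.P t').complex.d i _).hom -
        (s * r) • (f.1 ∘ₗ ((D.φ t t' h).f i).hom)) = 0 := by
      rw [LH_sub, LH_d, LH_smul, LH_φ, ← hw, LinearMap.smul_comp, hw', map_mul, mul_smul, sub_eq_zero]
      rfl
    obtain ⟨s', hs', e'⟩ := LH_inj S M J D t' i (hD _ _) _ e
    refine ⟨s' * s, S.mul_mem hs' hs, ?_⟩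
    rw [← map_smul, ← map_smul, h2]
    refine ⟨t', h, s' • w, ?_⟩
    rw [smul_sub, sub_eq_zero] at e'
    rw [LinearMap.smul_comp, e', ← mul_smul, ← mul_assoc, mul_smul]
    rfl
  · intro H x
    obtain ⟨t, g, rfl⟩ := h1' x
    have hg : g.1 ∘ₗ (((locPowRes S J D).P t).complex.d (i+1) i).hom = 0 := g.2
    obtain ⟨s, hs, f, hf⟩ := LH_surj S M J D t _ (hD _ _) g.1
    have e : LH S M J D t (i+1) (f ∘ₗ ((D.P t).complex.d (i+1) i).hom) = 0 := by
      rw [LH_d, ← hf, LinearMap.smul_comp, hg, smul_zero]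
    obtain ⟨s', hs', e'⟩ := LH_inj S M J D t _ (hD _ _) _ e
    obtain ⟨s'', hs'', e''⟩ := H (π t ⟨s' • f, e'⟩)
    rw [← map_smul, ← map_smul, h2] at e''
    obtain ⟨t', h, w, hw⟩ := e''
    have hw2 : w ∘ₗ ((D.P t').complex.d i _).hom =
      (s'' * r * s') • (f ∘ₗ ((D.φ t t' h).f i).hom) := by
      rw [hw, mul_smul, mul_smul]; rfl
    have k := congrArg (LH S M J D t' i) hw2
    rw [LH_d, LH_smul, LH_φ, ← hf] at k
    have k2 : algebraMap R (Localization S) (s'' * s' * s) •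
        (algebraMap R (Localization S) r • π' t g) = 0 := by
      rw [← map_smul, ← map_smul, h2']
      refine ⟨t', h, _, k.trans ?_⟩
      rw [LinearMap.smul_comp, ← mul_smul, ← map_mul]
      change _ = (algebraMap R (Localization S) (s'' * s' * s) • (algebraMap R (Localization S) r • g.1)) ∘ₗ _
      rw [LinearMap.smul_comp, LinearMap.smul_comp, ← mul_smul, ← map_mul]
      congr 2
      ring
    have hu : IsUnit (algebraMap R (Localization S) (s'' * s' * s)) :=
      IsLocalization.map_units _ (⟨_, S.mul_mem (S.mul_mem hs'' hs') hs⟩ : S)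
    exact hu.smul_eq_zero.1 k2

lemma kill_iff (b : Ideal R) (i k : ℕ) :
    (b.map (algebraMap R (Localization S))) ^ k • (⊤ : Submodule (Localization S)
      (locH (Localization S) (J.map (algebraMap R (Localization S))) i (LocalizedModule S M))) = ⊥ ↔
    ∀ r ∈ b ^ k, ∀ x : locH R J i M, ∃ s ∈ S, s • r • x = 0 := by
  rw [← Ideal.map_pow, eq_bot_iff, Submodule.smul_le]
  simp_rw [← kill_elt]
  constructor
  · intro h r hr x
    exact h _ (Ideal.mem_map_of_mem _ hr) x trivial
  · intro h r hr x _
    rw [Submodule.mem_bot]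
    have : Ideal.map (algebraMap R (Localization S)) (b ^ k) ≤ Module.annihilator _ (locH (Localization S) (J.map (algebraMap R (Localization S))) i (LocalizedModule S M)) := by
      rw [Ideal.map_le_iff_le_comap]
      intro r hr
      rw [Ideal.mem_comap, Module.mem_annihilator]
      exact h r hr
    exact Module.mem_annihilator.1 (this hr) x

end kill

lemma kill_supp {R : Type u} [CommRing R] {H : Type u} [AddCommGroup H] [Module R H]
    (I : Ideal R) (p : PrimeSpectrum R) :
    (∀ r ∈ I, ∀ x : H, ∃ s ∈ p.asIdeal.primeCompl, s • r • x = 0) ↔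
      p ∉ Module.support R ↥(I • (⊤ : Submodule R H)) := by
  rw [Module.mem_support_iff']
  push Not
  constructor
  · rintro h ⟨m, hm⟩
    suffices ∃ s ∈ p.asIdeal.primeCompl, s • m = 0 by
      obtain ⟨s, hs, e⟩ := this
      exact ⟨s, hs, Subtype.ext e⟩
    induction hm using Submodule.smul_induction_on' with
    | smul r hr x hx => exact h r hr x
    | add x hx y hy ihx ihy =>
      obtain ⟨s, hs, e⟩ := ihx
      obtain ⟨s', hs', e'⟩ := ihy
      refine ⟨s * s', mul_mem hs hs', ?_⟩
      rw [smul_add, mul_smul s s' y, e', mul_comm, mul_smul, e]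
      simp
  · intro h r hr x
    obtain ⟨s, hs, e⟩ := h ⟨r • x, Submodule.smul_mem_smul hr trivial⟩
    exact ⟨s, hs, congrArg Subtype.val e⟩

lemma le_dimSupp {R : Type u} [CommRing R] {N : Type u} [AddCommGroup N] [Module R N]
    (p : PrimeSpectrum R) (hp : p ∈ Module.support R N) :
    ringKrullDim (R ⧸ p.asIdeal) ≤ dimSupp R N := by
  rw [ringKrullDim_quotient, dimSupp]
  have hs : PrimeSpectrum.zeroLocus (p.asIdeal : Set R) ⊆ Module.support R N := fun q hq =>
    Module.mem_support_mono hq hp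
  exact Order.krullDim_le_of_strictMono (Set.inclusion hs) (fun x y h => h)

lemma exists_of_le_dimSupp {R : Type u} [CommRing R] {N : Type u} [AddCommGroup N] [Module R N]
    (n : ℕ) (h : (n : WithBot ℕ∞) ≤ dimSupp R N) :
    ∃ q ∈ Module.support R N, (n : WithBot ℕ∞) ≤ ringKrullDim (R ⧸ q.asIdeal) := by
  obtain ⟨l, hl⟩ := Order.le_krullDim_iff.1 h
  refine ⟨l.head.1, l.head.2, ?_⟩
  rw [ringKrullDim_quotient, Order.le_krullDim_iff]
  refine ⟨⟨l.length, fun i => ⟨(l i).1, ?_⟩, fun i => l.step i⟩, hl⟩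
  exact (LTSeries.head_le l i : _)

lemma exists_ass {R : Type u} [CommRing R] [IsNoetherianRing R] {H : Type u} [AddCommGroup H]
    [Module R H] (N : Submodule R H) (q : PrimeSpectrum R) (hq : q ∈ Module.support R N) :
    ∃ p ∈ Module.support R N, p ≤ q ∧ p.asIdeal ∈ associatedPrimes R H := by
  rw [Module.mem_support_iff_exists_annihilator] at hq
  obtain ⟨m, hm⟩ := hq
  obtain ⟨p, hp, hpq⟩ := Ideal.exists_minimalPrimes_le hm
  have hpp : p.IsPrime := hp.1.1
  have h1 := Module.associatedPrimes.minimalPrimes_annihilator_subset_associatedPrimes R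
    (Submodule.span R {m}) hp
  refine ⟨⟨p, hpp⟩, ?_, hpq, ?_⟩
  · rw [Module.mem_support_iff_exists_annihilator]
    exact ⟨m, hp.1.2⟩
  · exact associatedPrimes.subset_of_injective (f := N.subtype ∘ₗ (Submodule.span R {m}).subtype)
      (Subtype.val_injective.comp Subtype.val_injective) h1

/-- if `(Ass_R H_a^{f_a^b(M)_n}(M))_{≥ n}` is finite, then
`f_a^b(M)_n = f_a^b(M)^n`. -/
theorem fabn_eq_fabUpper (R : Type u) [CommRing R] [IsNoetherianRing R]
    (a b : Ideal R) (hba : b ≤ a)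
    (M : Type u) [AddCommGroup M] [Module R M] [Module.Finite R M] (n : ℕ)
    (hfin : ∀ i : ℕ, fabn R a b M n = (i : ℕ∞) →
      {p ∈ associatedPrimes R (locH R a i M) |
        (n : WithBot ℕ∞) ≤ ringKrullDim (R ⧸ p)}.Finite) :
    fabn R a b M n = fabUpper R a b M n := by
  have key : ∀ (p : PrimeSpectrum R) (i k : ℕ),
      (b.map (algebraMap R (Localization.AtPrime p.asIdeal))) ^ k •
        (⊤ : Submodule (Localization.AtPrime p.asIdeal) (locH (Localization.AtPrime p.asIdeal)
          (a.map (algebraMap R (Localization.AtPrime p.asIdeal))) i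
          (LocalizedModule p.asIdeal.primeCompl M))) ≠ ⊥ ↔
      p ∈ Module.support R ↥(b ^ k • (⊤ : Submodule R (locH R a i M))) := fun p i k => by
    rw [← not_not (a := p ∈ _), ← kill_supp]
    exact not_congr (kill_iff p.asIdeal.primeCompl M a b i k)
  apply le_antisymm
  · refine le_sInf ?_
    rintro _ ⟨p, hp, rfl⟩
    refine le_sInf ?_
    rintro _ ⟨i, hi, rfl⟩
    refine sInf_le ⟨i, fun t => ?_, rfl⟩
    exact hp.trans (le_dimSupp p ((key p i t).1 (hi t)))
  · by_cases htop : fabn R a b M n = ⊤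
    · rw [htop]; exact le_top
    obtain ⟨i, hi⟩ := ENat.ne_top_iff_exists.1 htop
    have hne : ((↑) '' {i : ℕ | ∀ t : ℕ, (n : WithBot ℕ∞) ≤
        dimSupp R ↥(b ^ t • (⊤ : Submodule R (locH R a i M)))} : Set ℕ∞).Nonempty := by
      by_contra h
      rw [Set.not_nonempty_iff_eq_empty] at h
      apply htop
      rw [fabn, h, sInf_empty]
    have hmem : fabn R a b M n ∈ _ := csInf_mem hne
    obtain ⟨j, hj, hji⟩ := hmem
    have hF := hfin j hji.symm
    rw [← hji]
    suffices ∃ p : PrimeSpectrum R, (n : WithBot ℕ∞) ≤ ringKrullDim (R ⧸ p.asIdeal) ∧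
        ∀ t, p ∈ Module.support R ↥(b ^ t • (⊤ : Submodule R (locH R a j M))) by
      obtain ⟨p, hp, hp'⟩ := this
      have h1 : fabUpper R a b M n ≤ fab (Localization.AtPrime p.asIdeal)
          (a.map (algebraMap R (Localization.AtPrime p.asIdeal)))
          (b.map (algebraMap R (Localization.AtPrime p.asIdeal)))
          (LocalizedModule p.asIdeal.primeCompl M) := sInf_le ⟨p, hp, rfl⟩
      exact h1.trans (sInf_le ⟨j, fun t => (key p j t).2 (hp' t), rfl⟩)
    by_contra! hcon
    choose! τ hτ using hcon
    classical
    let T : Ideal R → ℕ := fun p => if h : p.IsPrime then τ ⟨p, h⟩ else 0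
    obtain ⟨t, ht⟩ := (hF.image T).bddAbove
    obtain ⟨q, hq, hqn⟩ := exists_of_le_dimSupp n (hj t)
    obtain ⟨p, hp, hpq, hpa⟩ := exists_ass _ q hq
    have hpn : (n : WithBot ℕ∞) ≤ ringKrullDim (R ⧸ p.asIdeal) :=
      hqn.trans (ringKrullDim_le_of_surjective (Ideal.Quotient.factor hpq)
        (Ideal.Quotient.factor_surjective hpq))
    have hle : τ p ≤ t := by
      have := ht ⟨p.asIdeal, ⟨hpa, hpn⟩, rfl⟩
      simpa [T, p.2] using this
    apply hτ p hpn
    have hsub : b ^ t • (⊤ : Submodule R (locH R a j M)) ≤ b ^ (τ p) • ⊤ :=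
      Submodule.smul_mono_left (Ideal.pow_le_pow_right hle)
    exact Module.support_subset_of_injective (Submodule.inclusion hsub)
      (Submodule.inclusion_injective hsub) hp
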